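/- Let F ∈ Cont, let ξ be an initial segment of I, and let X_1, X_2 ∈ Perf satisfy X_1↾ξ = X_2↾ξ. Then either F is reducible to ξ on X_1 ∪ X_2, or there exist sets X'_1, X'_2 ∈ Perf with X'_1 ⊆ X_1 and X'_2 ⊆ X_2 such that again X'_1↾ξ = X'_2↾ξ and the images satisfy F''X'_1 ∩ F''X'_2 = ∅. -/

import Mathlib

open Set

abbrev Cantor : Type := ℕ → Bool

section
variable {I : Type}

/-- Restriction of a point of `D^η` to `D^ξ` (for `ξ ⊆ η`). -/
def restrictFn {ξ η : Set I} (h : ξ ⊆ η) (x : ↥η → Cantor) : ↥ξ → Cantor :=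
  fun j => x ⟨j.1, h j.2⟩

/-- Projection `X↾ξ` of a set `X ⊆ D^η`. -/
def resSet {ξ η : Set I} (h : ξ ⊆ η) (X : Set (↥η → Cantor)) : Set (↥ξ → Cantor) :=
  restrictFn h '' X

/-- Inverse projection `Y↾⁻¹η` of a set `Y ⊆ D^ξ`. -/
def resPre {ξ η : Set I} (h : ξ ⊆ η) (Y : Set (↥ξ → Cantor)) : Set (↥η → Cantor) :=
  {y | restrictFn h y ∈ Y}

/-- `A` is (relatively) open in `B`. -/
def RelOpen {α : Type*} [TopologicalSpace α] (A B : Set α) : Prop :=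
  ∃ U, IsOpen U ∧ A = U ∩ B

/-- `A` is (relatively) closed in `B`. -/
def RelClosed {α : Type*} [TopologicalSpace α] (A B : Set α) : Prop :=
  ∃ U, IsClosed U ∧ A = U ∩ B

/-- `A` is (relatively) clopen in `B`. -/
def RelClopen {α : Type*} [TopologicalSpace α] (A B : Set α) : Prop :=
  RelOpen A B ∧ RelClosed A B

open Classical in
/-- The union `x ∪ y` of two partial points agreeing on the common domain. -/
noncomputable def glue {ξ η : Set I} (x : ↥ξ → Cantor) (y : ↥η → Cantor) :
    ↥(ξ ∪ η) → Cantor :=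
  fun j => if h : j.1 ∈ ξ then x ⟨j.1, h⟩
           else y ⟨j.1, ((Set.mem_union j.1 ξ η).mp j.2).resolve_left h⟩

variable [PartialOrder I]

/-- `[<i]`. -/
def seg (i : I) : Set I := {j | j < i}

/-- `[≤i]`. -/
def segLe (i : I) : Set I := {j | j ≤ i}

/-- `[≯i]`. -/
def segNG (i : I) : Set I := {j | ¬ i < j}

lemma seg_subset {ζ : Set I} (hζ : IsLowerSet ζ) {i : I} (hi : i ∈ ζ) : seg i ⊆ ζ :=
  fun _ hj => hζ (le_of_lt hj) hi

lemma segLe_subset {ζ : Set I} (hζ : IsLowerSet ζ) {i : I} (hi : i ∈ ζ) : segLe i ⊆ ζ :=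
  fun _ hj => hζ hj hi

lemma isLowerSet_segLe (i : I) : IsLowerSet (segLe i) :=
  fun _ _ hba ha => le_trans hba ha

lemma seg_subset_segLe (i : I) : seg i ⊆ segLe i :=
  fun _ hj => le_of_lt hj

lemma mem_segLe_self (i : I) : i ∈ segLe i := le_refl i

/-- `D_{Xz}(i) = {x(i) : x ∈ X, x↾(<i) = z}`. -/
def Dxz {ζ : Set I} (X : Set (↥ζ → Cantor)) {i : I} (hi : i ∈ ζ) (h : seg i ⊆ ζ)
    (z : ↥(seg i) → Cantor) : Set Cantor :=
  {c | ∃ x ∈ X, restrictFn h x = z ∧ x ⟨i, hi⟩ = c}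

/-- Pre-conditions `IPe(ζ)`. -/
def IPe (ζ : Set I) (hζ : IsLowerSet ζ) (X : Set (↥ζ → Cantor)) : Prop :=
  -- P-1
  (IsClosed X ∧ X.Nonempty) ∧
  -- P-2
  (∀ (i : I) (hi : i ∈ ζ), ∀ z ∈ resSet (seg_subset hζ hi) X,
      Perfect (Dxz X hi (seg_subset hζ hi) z)) ∧
  -- P-3
  (∀ (i : I) (hi : i ∈ ζ), ∀ G : Set Cantor, IsOpen G →
      RelOpen
        ({z | ∃ x ∈ X, x ⟨i, hi⟩ ∈ G ∧ restrictFn (seg_subset hζ hi) x = z} :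
          Set (↥(seg i) → Cantor))
        (resSet (seg_subset hζ hi) X)) ∧
  -- P-4
  (∀ ξ η : Set I, IsLowerSet ξ → IsLowerSet η → ∀ (hξ : ξ ⊆ ζ) (hη : η ⊆ ζ),
      ∀ x ∈ resSet hξ X, ∀ y ∈ resSet hη X,
        restrictFn (Set.inter_subset_left : ξ ∩ η ⊆ ξ) x =
          restrictFn (Set.inter_subset_right : ξ ∩ η ⊆ η) y →
        glue x y ∈ resSet (Set.union_subset hξ hη) X)

/-- `stem(A)`: the length of the longest common initial segment of members of `A`. -/
noncomputable def stem (A : Set Cantor) : ℕ :=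
  sInf {n | ∃ a ∈ A, ∃ b ∈ A, a n ≠ b n}

/-- `Spl(A,e)` for `A ⊆ D`. -/
def SplD (A : Set Cantor) (e : Bool) : Set Cantor :=
  {a ∈ A | a (stem A) = e}

/-- `Spl(X,i,e)` for `X ⊆ D^ζ`. -/
def Spl {ζ : Set I} (hζ : IsLowerSet ζ) (X : Set (↥ζ → Cantor)) {i : I} (hi : i ∈ ζ)
    (e : Bool) : Set (↥ζ → Cantor) :=
  {x ∈ X |
    x ⟨i, hi⟩ ∈
      SplD (Dxz X hi (seg_subset hζ hi) (restrictFn (seg_subset hζ hi) x)) e}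

/-- A `ζ`-admissible function: `Φ : ω → ζ` taking each value of `ζ` infinitely often. -/
def Admissible (ζ : Set I) (Φ : ℕ → I) : Prop :=
  (∀ n, Φ n ∈ ζ) ∧ ∀ i ∈ ζ, ∀ N : ℕ, ∃ n, N ≤ n ∧ Φ n = i

/-- The sets `X_Φ[u]` for finite binary sequences `u`. -/
def XPhi {ζ : Set I} (hζ : IsLowerSet ζ) (Φ : ℕ → I) (hΦ : ∀ n, Φ n ∈ ζ)
    (X : Set (↥ζ → Cantor)) : (m : ℕ) → (Fin m → Bool) → Set (↥ζ → Cantor)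
  | 0, _ => X
  | m + 1, u =>
      Spl hζ (XPhi hζ Φ hΦ X m (fun k => u k.castSucc)) (hΦ m) (u (Fin.last m))

/-- `X` is shrinkable: each `X_Φ[a]` is a singleton. -/
def Shrinkable {ζ : Set I} (hζ : IsLowerSet ζ) (X : Set (↥ζ → Cantor)) : Prop :=
  ∀ (Φ : ℕ → I) (hΦ : Admissible ζ Φ) (a : ℕ → Bool),
    ∃ x, (⋂ m : ℕ, XPhi hζ Φ hΦ.1 X m (fun k => a k.1)) = {x}

/-- Conditions `Pe(ζ)`: shrinkable pre-conditions. -/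
def Pe (ζ : Set I) (hζ : IsLowerSet ζ) (X : Set (↥ζ → Cantor)) : Prop :=
  IPe ζ hζ X ∧ Shrinkable hζ X

/-- `Perf = Pe(I)`. -/
def Perf (X : Set (↥(Set.univ : Set I) → Cantor)) : Prop :=
  Pe Set.univ isLowerSet_univ X

/-- The initial segments `ξ[u,v]`. -/
def xiUV (Φ : ℕ → I) : (m : ℕ) → (Fin m → Bool) → (Fin m → Bool) → Set I
  | 0, _, _ => Set.univ
  | m + 1, u, v =>
      if u (Fin.last m) = v (Fin.last m) then
        xiUV Φ m (fun k => u k.castSucc) (fun k => v k.castSucc)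
      else
        xiUV Φ m (fun k => u k.castSucc) (fun k => v k.castSucc) ∩ segNG (Φ m)

/-- A `Φ`-splitting system of order `m`. -/
def SplittingSystem (Φ : ℕ → I) (m : ℕ)
    (X : (n : ℕ) → (Fin n → Bool) → Set (↥(Set.univ : Set I) → Cantor)) : Prop :=
  (∀ n, n ≤ m → ∀ u : Fin n → Bool, Perf (X n u)) ∧
  -- S-1
  (∀ n, n < m → ∀ (u : Fin n → Bool) (e : Bool),
      X (n + 1) (Fin.snoc u e) ⊆
        Spl isLowerSet_univ (X n u) (Set.mem_univ (Φ n)) e) ∧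
  -- S-2
  (∀ n, n ≤ m → ∀ u v : Fin n → Bool,
      resSet (Set.subset_univ (xiUV Φ n u v)) (X n u) =
        resSet (Set.subset_univ (xiUV Φ n u v)) (X n v)) ∧
  -- S-3
  (∀ n, n ≤ m → ∀ u v : Fin n → Bool, ∀ i : I, i ∉ xiUV Φ n u v →
      resSet (Set.subset_univ (segLe i)) (X n u) ∩
        resSet (Set.subset_univ (segLe i)) (X n v) = ∅)

/-- `F` is reducible to `ξ` on `X`. -/
def Reducible {β : Type*} (F : (↥(Set.univ : Set I) → Cantor) → β) (ξ : Set I)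
    (X : Set (↥(Set.univ : Set I) → Cantor)) : Prop :=
  ∀ x ∈ X, ∀ y ∈ X,
    restrictFn (Set.subset_univ ξ) x = restrictFn (Set.subset_univ ξ) y → F x = F y

/-- `F` captures `i` on `X`. -/
def Captures {β : Type*} (F : (↥(Set.univ : Set I) → Cantor) → β) (i : I)
    (X : Set (↥(Set.univ : Set I) → Cantor)) : Prop :=
  ∀ x ∈ X, ∀ y ∈ X, F x = F y → x ⟨i, Set.mem_univ i⟩ = y ⟨i, Set.mem_univ i⟩

/-- Borel sets of finite level: level `0` = closed sets, level `n+1` = countable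
unions or countable intersections of sets of level `n`. -/
def BorelLevel {α : Type*} [TopologicalSpace α] : ℕ → Set (Set α)
  | 0 => {C | IsClosed C}
  | n + 1 =>
      {S | (∃ f : ℕ → Set α, (∀ k, f k ∈ BorelLevel n) ∧ S = ⋃ k, f k) ∨
           (∃ f : ℕ → Set α, (∀ k, f k ∈ BorelLevel n) ∧ S = ⋂ k, f k)}

end

section
variable {I : Type}

lemma restrictFn_eq_iff {ξ ζ : Set I} (h : ξ ⊆ ζ) {x y : ↥ζ → Cantor} :
    restrictFn h x = restrictFn h y ↔ ∀ j : ↥ζ, j.1 ∈ ξ → x j = y j :=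
  ⟨fun e j hj => congrFun e ⟨j.1, hj⟩, fun e => funext fun j => e ⟨j.1, h j.2⟩ j.2⟩

lemma continuous_restrictFn {ξ ζ : Set I} (h : ξ ⊆ ζ) :
    Continuous (restrictFn h : (↥ζ → Cantor) → _) :=
  continuous_pi fun j => continuous_apply (⟨j.1, h j.2⟩ : ↥ζ)

lemma exists_admissible_univ [Countable I] [Nonempty I] :
    ∃ Φ : ℕ → I, Admissible univ Φ := by
  obtain ⟨f, hf⟩ := exists_surjective_nat I
  refine ⟨fun n => f n.unpair.1, fun _ => mem_univ _, fun i _ N => ?_⟩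
  obtain ⟨k, rfl⟩ := hf i
  exact ⟨Nat.pair k N, Nat.right_le_pair k N, by simp⟩

lemma exists_ne_of_not_reducible {β : Type*} {F : (↥(univ : Set I) → Cantor) → β} {ξ : Set I}
    {X₁ X₂ : Set (↥(univ : Set I) → Cantor)}
    (hres : resSet (subset_univ ξ) X₁ = resSet (subset_univ ξ) X₂)
    (h : ¬ Reducible F ξ (X₁ ∪ X₂)) :
    ∃ x ∈ X₁, ∃ y ∈ X₂, restrictFn (subset_univ ξ) x = restrictFn (subset_univ ξ) y ∧
      F x ≠ F y := by
  by_contra! hF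
  refine h fun x hx y hy hxy => ?_
  rcases hx with hx | hx <;> rcases hy with hy | hy
  · obtain ⟨w, hw, hwx⟩ := hres.subset ⟨x, hx, rfl⟩
    exact (hF x hx w hw hwx.symm).trans (hF y hy w hw (hxy.symm.trans hwx.symm)).symm
  · exact hF x hx y hy hxy
  · exact (hF y hy x hx hxy.symm).symm
  · obtain ⟨w, hw, hwx⟩ := hres.symm.subset ⟨x, hx, rfl⟩
    exact (hF w hw x hx hwx).symm.trans (hF w hw y hy (hwx.trans hxy))

lemma isClopen_setOf_apply_eq (n : ℕ) (e : Bool) : IsClopen {c : Cantor | c n = e} :=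
  (isClopen_discrete {e}).preimage (f := fun c : Cantor => c n) (continuous_apply n)

variable [PartialOrder I] {ζ : Set I} {hζ : IsLowerSet ζ} {X : Set (↥ζ → Cantor)}

lemma mem_Spl_iff {i : I} (hi : i ∈ ζ) {e : Bool} {x : ↥ζ → Cantor} :
    x ∈ Spl hζ X hi e ↔ x ∈ X ∧
      x ⟨i, hi⟩ (stem (Dxz X hi (seg_subset hζ hi) (restrictFn (seg_subset hζ hi) x))) = e :=
  ⟨fun h => ⟨h.1, h.2.2⟩, fun h => ⟨h.1, ⟨x, h.1, rfl, rfl⟩, h.2⟩⟩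

lemma Spl_subset {i : I} (hi : i ∈ ζ) (e : Bool) : Spl hζ X hi e ⊆ X := fun _ h => h.1

lemma IPe.amalgamate (hX : IPe ζ hζ X) {ξ η : Set I} (hξ : IsLowerSet ξ) (hη : IsLowerSet η)
    (hξζ : ξ ⊆ ζ) (hηζ : η ⊆ ζ) {x y : ↥ζ → Cantor} (hx : x ∈ X) (hy : y ∈ X)
    (hxy : ∀ j : ↥ζ, j.1 ∈ ξ → j.1 ∈ η → x j = y j) :
    ∃ w ∈ X, (∀ j : ↥ζ, j.1 ∈ ξ → w j = x j) ∧ (∀ j : ↥ζ, j.1 ∈ η → w j = y j) := by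
  obtain ⟨w, hw, e⟩ := hX.2.2.2 ξ η hξ hη hξζ hηζ _ ⟨x, hx, rfl⟩ _ ⟨y, hy, rfl⟩
    (funext fun j => hxy ⟨j.1, hξζ j.2.1⟩ j.2.1 j.2.2)
  have key : ∀ j : ↥ζ, j.1 ∈ ξ → w j = x j := by
    intro j hj
    have := congrFun e ⟨j.1, Or.inl hj⟩
    simpa [glue, restrictFn, hj] using this
  refine ⟨w, hw, key, fun j hj => ?_⟩
  by_cases hjξ : j.1 ∈ ξ
  · rw [key j hjξ, hxy j hjξ hj]
  · have := congrFun e ⟨j.1, Or.inr hj⟩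
    simpa [glue, restrictFn, hjξ] using this

lemma exists_ne_at_stem {A : Set Cantor} (hA : Perfect A) (hne : A.Nonempty) :
    ∃ a ∈ A, ∃ b ∈ A, a (stem A) ≠ b (stem A) := by
  obtain ⟨c, hc⟩ := hne
  obtain ⟨d, ⟨-, hd⟩, hdc⟩ := (accPt_iff_nhds.1 (hA.acc c hc)) univ Filter.univ_mem
  obtain ⟨n, hn⟩ := Function.ne_iff.1 hdc
  exact Nat.sInf_mem (s := {n | ∃ a ∈ A, ∃ b ∈ A, a n ≠ b n}) ⟨n, d, hd, c, hc, hn⟩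

lemma eq_of_lt_stem {A : Set Cantor} {a b : Cantor} (ha : a ∈ A) (hb : b ∈ A) {k : ℕ}
    (hk : k < stem A) : a k = b k := by
  by_contra h
  exact Nat.notMem_of_lt_sInf hk ⟨a, ha, b, hb, h⟩

lemma stem_eq {A : Set Cantor} {n : ℕ} {a b c : Cantor} (ha : a ∈ A) (hb : b ∈ A)
    (hab : a n ≠ b n) (hc : ∀ d ∈ A, ∀ k < n, d k = c k) : stem A = n := by
  apply le_antisymm
  · exact Nat.sInf_le ⟨a, ha, b, hb, hab⟩
  · by_contra! h
    obtain ⟨a', ha', b', hb', h'⟩ :=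
      Nat.sInf_mem (s := {n | ∃ a ∈ A, ∃ b ∈ A, a n ≠ b n}) ⟨n, a, ha, b, hb, hab⟩
    exact h' ((hc a' ha' _ h).trans (hc b' hb' _ h).symm)

lemma IPe.exists_mem_Spl_agree_seg (hX : IPe ζ hζ X) {i : I} (hi : i ∈ ζ) (e : Bool)
    {x : ↥ζ → Cantor} (hx : x ∈ X) :
    ∃ w ∈ Spl hζ X hi e, ∀ j : ↥ζ, j.1 ∈ seg i → w j = x j := by
  obtain ⟨a, ⟨xa, hxa, ra, rfl⟩, b, ⟨xb, hxb, rb, rfl⟩, hab⟩ :=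
    exists_ne_at_stem (hX.2.1 i hi _ ⟨x, hx, rfl⟩) ⟨x ⟨i, hi⟩, x, hx, rfl, rfl⟩
  by_cases h : xa ⟨i, hi⟩
      (stem (Dxz X hi (seg_subset hζ hi) (restrictFn (seg_subset hζ hi) x))) = e
  · exact ⟨xa, (mem_Spl_iff hi).2 ⟨hxa, by rw [ra]; exact h⟩, (restrictFn_eq_iff _).1 ra⟩
  · refine ⟨xb, (mem_Spl_iff hi).2 ⟨hxb, ?_⟩, (restrictFn_eq_iff _).1 rb⟩
    rw [rb]
    revert h hab
    generalize xa _ _ = p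
    generalize xb _ _ = q
    cases p <;> cases q <;> cases e <;> simp

lemma mem_Spl_of_agree {i : I} (hi : i ∈ ζ) {e : Bool} {ξ : Set I} (hξ : IsLowerSet ξ)
    (hiξ : i ∈ ξ) {x y : ↥ζ → Cantor} (hx : x ∈ X) (hy : y ∈ Spl hζ X hi e)
    (hxy : ∀ j : ↥ζ, j.1 ∈ ξ → x j = y j) : x ∈ Spl hζ X hi e := by
  have hr : restrictFn (seg_subset hζ hi) x = restrictFn (seg_subset hζ hi) y :=
    (restrictFn_eq_iff _).2 fun j hj => hxy j (hξ (le_of_lt hj) hiξ)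
  rw [mem_Spl_iff] at hy ⊢
  rw [hr, hxy ⟨i, hi⟩ hiξ]
  exact ⟨hx, hy.2⟩

lemma IPe.exists_mem_Spl_agree (hX : IPe ζ hζ X) {i : I} (hi : i ∈ ζ) (e : Bool) {ξ : Set I}
    (hξ : IsLowerSet ξ) (hξζ : ξ ⊆ ζ) (hiξ : i ∉ ξ) {x : ↥ζ → Cantor} (hx : x ∈ X) :
    ∃ w ∈ Spl hζ X hi e, ∀ j : ↥ζ, j.1 ∈ ξ → w j = x j := by
  obtain ⟨y, hy, hyx⟩ := hX.exists_mem_Spl_agree_seg hi e hx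
  obtain ⟨w, hw, h1, h2⟩ := hX.amalgamate hξ (isLowerSet_segLe i) hξζ (segLe_subset hζ hi) hx hy.1
    (fun j hj hj' => (hyx j (lt_of_le_of_ne hj' fun h => hiξ (h ▸ hj))).symm)
  exact ⟨w, mem_Spl_of_agree hi (isLowerSet_segLe i) (mem_segLe_self i) hw hy h2, h1⟩

lemma IPe.exists_mem_Spl_agree_segLe (hX : IPe ζ hζ X) {i j : I} (hi : i ∈ ζ) (hj : j ∈ ζ)
    (hij : j ≠ i) {e : Bool} {x y : ↥ζ → Cantor} (hx : x ∈ X) (hy : y ∈ Spl hζ X hi e)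
    (hxy : ∀ k : ↥ζ, k.1 ∈ seg j → x k = y k) :
    ∃ w ∈ Spl hζ X hi e, ∀ k : ↥ζ, k.1 ∈ segLe j → w k = x k := by
  by_cases h : i < j
  · exact ⟨x, mem_Spl_of_agree hi (fun _ _ hba ha => lt_of_le_of_lt hba ha) h hx hy hxy,
      fun _ _ => rfl⟩
  · exact hX.exists_mem_Spl_agree hi e (isLowerSet_segLe j) (segLe_subset hζ hj)
      (fun h' => h (lt_of_le_of_ne h' hij.symm)) hx

lemma IPe.exists_isOpen_stem_eq (hX : IPe ζ hζ X) {i : I} (hi : i ∈ ζ)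
    {z : ↥(seg i) → Cantor} (hz : z ∈ resSet (seg_subset hζ hi) X) :
    ∃ U, IsOpen U ∧ z ∈ U ∧ ∀ z' ∈ U, z' ∈ resSet (seg_subset hζ hi) X →
      stem (Dxz X hi (seg_subset hζ hi) z') = stem (Dxz X hi (seg_subset hζ hi) z) := by
  have hz' := hz
  obtain ⟨x, hx, rfl⟩ := hz'
  set r := restrictFn (ξ := seg i) (seg_subset hζ hi)
  set n := stem (Dxz X hi (seg_subset hζ hi) (r x))
  obtain ⟨a, ha, b, hb, hab⟩ :=
    exists_ne_at_stem (hX.2.1 i hi _ hz) ⟨x ⟨i, hi⟩, x, hx, rfl, rfl⟩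
  obtain ⟨Ua, hUa, ea⟩ := hX.2.2.1 i hi _ (isClopen_setOf_apply_eq n (a n)).2
  obtain ⟨Ub, hUb, eb⟩ := hX.2.2.1 i hi _ (isClopen_setOf_apply_eq n (b n)).2
  have hP : IsOpen {d : Cantor | ∀ k < n, d k = x ⟨i, hi⟩ k} := by
    have : {d : Cantor | ∀ k < n, d k = x ⟨i, hi⟩ k} =
        ⋂ k ∈ Iio n, {d : Cantor | d k = x ⟨i, hi⟩ k} := by
      ext; simp
    rw [this]
    exact (finite_Iio n).isOpen_biInter fun k _ =>
      (isClopen_setOf_apply_eq k _).2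
  have hK : IsClosed (r '' (X ∩ {y | y ⟨i, hi⟩ ∈ {d : Cantor | ∀ k < n, d k = x ⟨i, hi⟩ k}ᶜ})) :=
    ((hX.1.1.inter (hP.isClosed_compl.preimage
      (continuous_apply (⟨i, hi⟩ : ↥ζ)))).isCompact.image (continuous_restrictFn _)).isClosed
  refine ⟨Ua ∩ Ub ∩ (r '' (X ∩ {y | y ⟨i, hi⟩ ∈ {d : Cantor | ∀ k < n, d k = x ⟨i, hi⟩ k}ᶜ}))ᶜ,
    (hUa.inter hUb).inter hK.isOpen_compl, ⟨⟨?_, ?_⟩, ?_⟩, ?_⟩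
  · obtain ⟨w, hw, h1, h2⟩ := ha
    exact (ea.le ⟨w, hw, congrFun h2 n, h1⟩).1
  · obtain ⟨w, hw, h1, h2⟩ := hb
    exact (eb.le ⟨w, hw, congrFun h2 n, h1⟩).1
  · rintro ⟨w, ⟨hw, hw'⟩, h1⟩
    refine hw' fun k hk => eq_of_lt_stem
      (A := Dxz X hi (seg_subset hζ hi) (r x)) ?_ ?_ hk
    · exact ⟨w, hw, h1, rfl⟩
    · exact ⟨x, hx, rfl, rfl⟩
  · rintro z' ⟨⟨h1, h2⟩, h3⟩ hz'
    obtain ⟨wa, hwa, ha1, ha2⟩ := ea.ge ⟨h1, hz'⟩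
    obtain ⟨wb, hwb, hb1, hb2⟩ := eb.ge ⟨h2, hz'⟩
    refine stem_eq (c := x ⟨i, hi⟩) ⟨wa, hwa, ha2, rfl⟩ ⟨wb, hwb, hb2, rfl⟩ ?_ ?_
    · rw [show wa ⟨i, hi⟩ n = a n from ha1, show wb ⟨i, hi⟩ n = b n from hb1]
      exact hab
    · rintro _ ⟨w, hw, hw', rfl⟩
      by_contra h
      exact h3 ⟨w, ⟨hw, h⟩, hw'⟩

lemma IPe.isClosed_Spl (hX : IPe ζ hζ X) {i : I} (hi : i ∈ ζ) (e : Bool) :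
    IsClosed (Spl hζ X hi e) := by
  rw [← isOpen_compl_iff, isOpen_iff_forall_mem_open]
  intro x hx
  by_cases hxX : x ∈ X
  · obtain ⟨U, hU, hxU, h⟩ := hX.exists_isOpen_stem_eq hi ⟨x, hxX, rfl⟩
    set n := stem (Dxz X hi (seg_subset hζ hi) (restrictFn (seg_subset hζ hi) x))
    refine ⟨restrictFn (seg_subset hζ hi) ⁻¹' U ∩ {y | y ⟨i, hi⟩ n ≠ e}, ?_,
      (hU.preimage (continuous_restrictFn _)).inter ?_, hxU, ?_⟩
    · rintro y ⟨hy1, hy2⟩ hy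
      rw [mem_Spl_iff, h _ hy1 ⟨y, hy.1, rfl⟩] at hy
      exact hy2 hy.2
    · exact (isClopen_setOf_apply_eq n e).compl.2.preimage
        (f := fun y : ↥ζ → Cantor => y ⟨i, hi⟩) (continuous_apply (⟨i, hi⟩ : ↥ζ))
    · exact fun h' => hx ((mem_Spl_iff hi).2 ⟨hxX, h'⟩)
  · exact ⟨Xᶜ, compl_subset_compl.2 (Spl_subset hi e), hX.1.1.isOpen_compl, hxX⟩

lemma IPe.spl (hX : IPe ζ hζ X) {i : I} (hi : i ∈ ζ) (e : Bool) :
    IPe ζ hζ (Spl hζ X hi e) := by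
  refine ⟨⟨hX.isClosed_Spl hi e, ?_⟩, ?_, ?_, ?_⟩
  · obtain ⟨x, hx⟩ := hX.1.2
    obtain ⟨w, hw, -⟩ := hX.exists_mem_Spl_agree_seg hi e hx
    exact ⟨w, hw⟩
  · rintro j hj z ⟨y, hy, rfl⟩
    have hp := hX.2.1 j hj _ ⟨y, hy.1, rfl⟩
    by_cases hji : j = i
    · subst hji
      set n := stem (Dxz X hi (seg_subset hζ hi) (restrictFn (seg_subset hζ hi) y))
      have hc := isClopen_setOf_apply_eq n e
      have : Dxz (Spl hζ X hi e) hj (seg_subset hζ hj) (restrictFn (seg_subset hζ hj) y) =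
          {c : Cantor | c n = e} ∩
            Dxz X hj (seg_subset hζ hj) (restrictFn (seg_subset hζ hj) y) := by
        ext c
        constructor
        · rintro ⟨w, hw, h1, rfl⟩
          rw [mem_Spl_iff, h1] at hw
          exact ⟨hw.2, w, hw.1, h1, rfl⟩
        · rintro ⟨hc, w, hw, h1, rfl⟩
          exact ⟨w, (mem_Spl_iff hi).2 ⟨hw, by rw [h1]; exact hc⟩, h1, rfl⟩
      rw [this]
      exact ⟨hc.1.inter hp.closed, hp.acc.open_inter hc.2⟩
    · convert hp using 1
      ext c
      constructor
      · rintro ⟨w, hw, h1, rfl⟩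
        exact ⟨w, hw.1, h1, rfl⟩
      · rintro ⟨x, hx, h1, rfl⟩
        obtain ⟨w, hw, h2⟩ := hX.exists_mem_Spl_agree_segLe hi hj hji hx hy
          ((restrictFn_eq_iff _).1 h1)
        exact ⟨w, hw, ((restrictFn_eq_iff _).2 fun k hk => h2 k (le_of_lt hk)).trans h1,
          h2 ⟨j, hj⟩ le_rfl⟩
  · intro j hj G hG
    by_cases hji : j = i
    · subst hji
      have hloc : ∀ z ∈ {z | ∃ x ∈ Spl hζ X hi e,
          x ⟨j, hj⟩ ∈ G ∧ restrictFn (seg_subset hζ hj) x = z},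
          ∃ U, IsOpen U ∧ z ∈ U ∧ U ∩ resSet (seg_subset hζ hj) X ⊆
            {z | ∃ x ∈ Spl hζ X hi e, x ⟨j, hj⟩ ∈ G ∧ restrictFn (seg_subset hζ hj) x = z} := by
        rintro _ ⟨x, hx, hxG, rfl⟩
        obtain ⟨U, hU, hxU, h⟩ := hX.exists_isOpen_stem_eq hj ⟨x, hx.1, rfl⟩
        set n := stem (Dxz X hi (seg_subset hζ hi) (restrictFn (seg_subset hζ hi) x))
        obtain ⟨V, hV, eV⟩ := hX.2.2.1 j hj (G ∩ {c : Cantor | c n = e})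
          (hG.inter (isClopen_setOf_apply_eq n e).2)
        refine ⟨U ∩ V, hU.inter hV,
          ⟨hxU, (eV.le ⟨x, hx.1, ⟨hxG, ((mem_Spl_iff hi).1 hx).2⟩, rfl⟩).1⟩, ?_⟩
        rintro z ⟨⟨hzU, hzV⟩, hz⟩
        obtain ⟨w, hw, ⟨hwG, hwn⟩, rfl⟩ := eV.ge ⟨hzV, hz⟩
        exact ⟨w, (mem_Spl_iff hi).2 ⟨hw, by rw [h _ hzU hz]; exact hwn⟩, hwG, rfl⟩
      choose! U hU hzU hsub using hloc
      refine ⟨⋃ z ∈ {z | ∃ x ∈ Spl hζ X hi e,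
          x ⟨j, hj⟩ ∈ G ∧ restrictFn (seg_subset hζ hj) x = z}, U z,
        isOpen_biUnion hU, Subset.antisymm ?_ ?_⟩
      · intro z hz
        refine ⟨mem_biUnion hz (hzU z hz), ?_⟩
        obtain ⟨x, hx, -, h⟩ := hz
        exact ⟨x, hx, h⟩
      · rintro z' ⟨hz', x, hx, rfl⟩
        obtain ⟨z, hz, hzz⟩ := mem_iUnion₂.1 hz'
        exact hsub z hz ⟨hzz, x, hx.1, rfl⟩
    · obtain ⟨U, hU, eU⟩ := hX.2.2.1 j hj G hG
      refine ⟨U, hU, Subset.antisymm ?_ ?_⟩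
      · rintro _ ⟨x, hx, hxG, rfl⟩
        exact ⟨(eU.le ⟨x, hx.1, hxG, rfl⟩).1, x, hx, rfl⟩
      · rintro _ ⟨hz, y, hy, rfl⟩
        obtain ⟨x, hx, hxG, h1⟩ := eU.ge ⟨hz, y, hy.1, rfl⟩
        obtain ⟨w, hw, h2⟩ := hX.exists_mem_Spl_agree_segLe hi hj hji hx hy
          ((restrictFn_eq_iff _).1 h1)
        refine ⟨w, hw, ?_, ((restrictFn_eq_iff _).2 fun k hk => h2 k (le_of_lt hk)).trans h1⟩
        rw [h2 ⟨j, hj⟩ le_rfl]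
        exact hxG
  · rintro ξ η hξ hη hξζ hηζ _ ⟨x, hx, rfl⟩ _ ⟨y, hy, rfl⟩ hxy
    obtain ⟨w, hw, h⟩ :=
      hX.2.2.2 ξ η hξ hη hξζ hηζ _ ⟨x, hx.1, rfl⟩ _ ⟨y, hy.1, rfl⟩ hxy
    rw [← h]
    have hwx : ∀ j : ↥ζ, j.1 ∈ ξ → w j = x j := by
      intro j hj
      simpa [glue, restrictFn, hj] using congrFun h ⟨j.1, Or.inl hj⟩
    have hwy : ∀ j : ↥ζ, j.1 ∈ η → w j = y j := by
      intro j hj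
      by_cases hjξ : j.1 ∈ ξ
      · rw [hwx j hjξ]
        exact congrFun hxy ⟨j.1, hjξ, hj⟩
      · simpa [glue, restrictFn, hjξ] using congrFun h ⟨j.1, Or.inr hj⟩
    by_cases hiξ : i ∈ ξ
    · exact ⟨w, mem_Spl_of_agree hi hξ hiξ hw hx hwx, rfl⟩
    by_cases hiη : i ∈ η
    · exact ⟨w, mem_Spl_of_agree hi hη hiη hw hy hwy, rfl⟩
    obtain ⟨v, hv, hvw⟩ := hX.exists_mem_Spl_agree hi e (hξ.union hη) (union_subset hξζ hηζ)
      (fun h => h.elim hiξ hiη) hw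
    exact ⟨v, hv, (restrictFn_eq_iff _).2 hvw⟩

/-- Prepending a splitting step to a splitting sequence. -/
lemma XPhi_cons {i : I} (hi : i ∈ ζ) {Φ : ℕ → I} (hΦ : ∀ n, Φ n ∈ ζ) (Φ' : ℕ → I)
    (hΦ' : ∀ n, Φ' n ∈ ζ) (h0 : Φ' 0 = i) (hs : ∀ n, Φ' (n + 1) = Φ n) (a a' : ℕ → Bool)
    (has : ∀ n, a' (n + 1) = a n) (m : ℕ) :
    XPhi hζ Φ' hΦ' X (m + 1) (fun k => a' k.1) =
      XPhi hζ Φ hΦ (Spl hζ X hi (a' 0)) m (fun k => a k.1) := by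
  obtain rfl : Φ = fun n => Φ' (n + 1) := funext fun n => (hs n).symm
  obtain rfl : a = fun n => a' (n + 1) := funext fun n => (has n).symm
  subst h0
  induction m with
  | zero => rfl
  | succ m ih => exact congrArg (fun Y => Spl hζ Y (hΦ' (m + 1)) (a' (m + 1))) ih

lemma XPhi_antitone {Φ : ℕ → I} (hΦ : ∀ n, Φ n ∈ ζ) (a : ℕ → Bool) :
    Antitone fun m => XPhi hζ Φ hΦ X m (fun k => a k.1) :=
  antitone_nat_of_succ_le fun m => Spl_subset (hΦ m) (a m)

lemma Shrinkable.spl (hX : Shrinkable hζ X) {i : I} (hi : i ∈ ζ) (e : Bool) :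
    Shrinkable hζ (Spl hζ X hi e) := by
  intro Φ hΦ a
  set Φ' : ℕ → I := fun n => Nat.casesOn n i Φ
  set a' : ℕ → Bool := fun n => Nat.casesOn n e a
  have hΦ' : Admissible ζ Φ' := by
    refine ⟨fun n => ?_, fun j hj N => ?_⟩
    · cases n with
      | zero => exact hi
      | succ n => exact hΦ.1 n
    · obtain ⟨n, hn, h⟩ := hΦ.2 j hj N
      exact ⟨n + 1, by omega, h⟩
  obtain ⟨x, hx⟩ := hX Φ' hΦ' a'
  refine ⟨x, ?_⟩
  rw [← hx]
  exact (iInter_congr fun m =>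
    (XPhi_cons hi hΦ.1 Φ' hΦ'.1 rfl (fun _ => rfl) a a' (fun _ => rfl) m).symm).trans
    ((XPhi_antitone hΦ'.1 a').iInf_nat_add 1)

lemma Pe.spl (hX : Pe ζ hζ X) {i : I} (hi : i ∈ ζ) (e : Bool) : Pe ζ hζ (Spl hζ X hi e) :=
  ⟨hX.1.spl hi e, hX.2.spl hi e⟩

lemma Pe.pe_XPhi (hX : Pe ζ hζ X) {Φ : ℕ → I} (hΦ : ∀ n, Φ n ∈ ζ) (m : ℕ) (u : Fin m → Bool) :
    Pe ζ hζ (XPhi hζ Φ hΦ X m u) := by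
  induction m with
  | zero => exact hX
  | succ m ih => exact (ih _).spl _ _

lemma exists_forall_mem_XPhi {Φ : ℕ → I} (hΦ : ∀ n, Φ n ∈ ζ) {x : ↥ζ → Cantor} (hx : x ∈ X) :
    ∃ a : ℕ → Bool, ∀ m, x ∈ XPhi hζ Φ hΦ X m (fun k => a k.1) := by
  let c : ℕ → Set (↥ζ → Cantor) → Bool := fun m Y => x ⟨Φ m, hΦ m⟩
    (stem (Dxz Y (hΦ m) (seg_subset hζ (hΦ m)) (restrictFn (seg_subset hζ (hΦ m)) x)))
  let S : ℕ → Set (↥ζ → Cantor) := fun m =>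
    Nat.rec X (fun m Y => Spl hζ Y (hΦ m) (c m Y)) m
  have hS : ∀ m, XPhi hζ Φ hΦ X m (fun k => c k.1 (S k.1)) = S m := by
    intro m
    induction m with
    | zero => rfl
    | succ m ih => exact congrArg (fun Y => Spl hζ Y (hΦ m) (c m (S m))) ih
  refine ⟨fun m => c m (S m), fun m => ?_⟩
  rw [hS]
  induction m with
  | zero => exact hx
  | succ m ih => exact (mem_Spl_iff (hΦ m)).2 ⟨ih, rfl⟩

lemma resSet_Spl_of_notMem (hX : IPe ζ hζ X) {i : I} (hi : i ∈ ζ) (e : Bool) {ξ : Set I}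
    (hξ : IsLowerSet ξ) (hξζ : ξ ⊆ ζ) (hiξ : i ∉ ξ) :
    resSet hξζ (Spl hζ X hi e) = resSet hξζ X := by
  refine Subset.antisymm (image_mono (Spl_subset hi e)) ?_
  rintro _ ⟨x, hx, rfl⟩
  obtain ⟨w, hw, h⟩ := hX.exists_mem_Spl_agree hi e hξ hξζ hiξ hx
  exact ⟨w, hw, (restrictFn_eq_iff _).2 h⟩

lemma Dxz_subset_of_resSet_subset {Y : Set (↥ζ → Cantor)} {ξ : Set I} (hξ : IsLowerSet ξ)
    (hξζ : ξ ⊆ ζ) (h : resSet hξζ X ⊆ resSet hξζ Y) {i : I} (hi : i ∈ ζ) (hiξ : i ∈ ξ)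
    (z : ↥(seg i) → Cantor) :
    Dxz X hi (seg_subset hζ hi) z ⊆ Dxz Y hi (seg_subset hζ hi) z := by
  rintro _ ⟨x, hx, rfl, rfl⟩
  obtain ⟨y, hy, hyx⟩ := h ⟨x, hx, rfl⟩
  rw [restrictFn_eq_iff] at hyx
  exact ⟨y, hy, (restrictFn_eq_iff _).2 fun j hj => hyx j (hξ (le_of_lt hj) hiξ),
    hyx ⟨i, hi⟩ hiξ⟩

lemma Dxz_congr_of_resSet_eq {Y : Set (↥ζ → Cantor)} {ξ : Set I} (hξ : IsLowerSet ξ)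
    (hξζ : ξ ⊆ ζ) (h : resSet hξζ X = resSet hξζ Y) {i : I} (hi : i ∈ ζ) (hiξ : i ∈ ξ)
    {x y : ↥ζ → Cantor} (hxy : restrictFn hξζ x = restrictFn hξζ y) :
    Dxz X hi (seg_subset hζ hi) (restrictFn (seg_subset hζ hi) x) =
      Dxz Y hi (seg_subset hζ hi) (restrictFn (seg_subset hζ hi) y) := by
  have hr : restrictFn (seg_subset hζ hi) x = restrictFn (seg_subset hζ hi) y :=
    (restrictFn_eq_iff _).2 fun j hj =>
      (restrictFn_eq_iff _).1 hxy j (hξ (le_of_lt hj) hiξ)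
  rw [hr]
  exact Subset.antisymm (Dxz_subset_of_resSet_subset (hζ := hζ) hξ hξζ h.subset hi hiξ _)
    (Dxz_subset_of_resSet_subset (hζ := hζ) hξ hξζ h.symm.subset hi hiξ _)

lemma resSet_Spl_subset_of_mem {Y : Set (↥ζ → Cantor)} {ξ : Set I} (hξ : IsLowerSet ξ)
    (hξζ : ξ ⊆ ζ) (h : resSet hξζ X = resSet hξζ Y) {i : I} (hi : i ∈ ζ) (hiξ : i ∈ ξ)
    (e : Bool) : resSet hξζ (Spl hζ X hi e) ⊆ resSet hξζ (Spl hζ Y hi e) := by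
  rintro _ ⟨x, hx, rfl⟩
  rw [mem_Spl_iff] at hx
  obtain ⟨y, hy, hyx⟩ := h.subset ⟨x, hx.1, rfl⟩
  refine ⟨y, (mem_Spl_iff hi).2 ⟨hy, ?_⟩, hyx⟩
  rw [← Dxz_congr_of_resSet_eq (hζ := hζ) hξ hξζ h hi hiξ hyx.symm,
    (restrictFn_eq_iff _).1 hyx ⟨i, hi⟩ hiξ]
  exact hx.2

/-- Splitting along two points with the same restriction to `ξ` keeps the projections to `ξ`
equal. -/
lemma resSet_XPhi_eq {Y : Set (↥ζ → Cantor)} (hX : Pe ζ hζ X) (hY : Pe ζ hζ Y) {ξ : Set I}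
    (hξ : IsLowerSet ξ) (hξζ : ξ ⊆ ζ) (h : resSet hξζ X = resSet hξζ Y)
    {Φ : ℕ → I} (hΦ : ∀ n, Φ n ∈ ζ) {x y : ↥ζ → Cantor}
    (hxy : restrictFn hξζ x = restrictFn hξζ y) {a b : ℕ → Bool}
    (hx : ∀ m, x ∈ XPhi hζ Φ hΦ X m (fun k => a k.1))
    (hy : ∀ m, y ∈ XPhi hζ Φ hΦ Y m (fun k => b k.1)) (m : ℕ) :
    resSet hξζ (XPhi hζ Φ hΦ X m (fun k => a k.1)) =
      resSet hξζ (XPhi hζ Φ hΦ Y m (fun k => b k.1)) := by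
  induction m with
  | zero => exact h
  | succ m ih =>
    change resSet hξζ (Spl hζ (XPhi hζ Φ hΦ X m (fun k => a k.1)) (hΦ m) (a m)) =
      resSet hξζ (Spl hζ (XPhi hζ Φ hΦ Y m (fun k => b k.1)) (hΦ m) (b m))
    by_cases hm : Φ m ∈ ξ
    · have hab : a m = b m := by
        refine ((mem_Spl_iff (hΦ m)).1 (hx (m + 1))).2.symm.trans
          (Eq.trans ?_ ((mem_Spl_iff (hΦ m)).1 (hy (m + 1))).2)
        rw [(restrictFn_eq_iff _).1 hxy ⟨Φ m, hΦ m⟩ hm]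
        exact congrArg (fun A => y ⟨Φ m, hΦ m⟩ (stem A))
          (Dxz_congr_of_resSet_eq (hζ := hζ) hξ hξζ ih (hΦ m) hm hxy)
      rw [hab]
      exact Subset.antisymm (resSet_Spl_subset_of_mem hξ hξζ ih (hΦ m) hm _)
        (resSet_Spl_subset_of_mem hξ hξζ ih.symm (hΦ m) hm _)
    · rw [resSet_Spl_of_notMem (hX.pe_XPhi hΦ m _).1 (hΦ m) _ hξ hξζ hm,
        resSet_Spl_of_notMem (hY.pe_XPhi hΦ m _).1 (hΦ m) _ hξ hξζ hm]
      exact ih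

lemma Pe.exists_XPhi_subset (hX : Pe ζ hζ X) {Φ : ℕ → I} (hΦ : Admissible ζ Φ)
    {x : ↥ζ → Cantor} {a : ℕ → Bool} (hx : ∀ m, x ∈ XPhi hζ Φ hΦ.1 X m (fun k => a k.1))
    {U : Set (↥ζ → Cantor)} (hU : IsOpen U) (hxU : x ∈ U) :
    ∃ m, XPhi hζ Φ hΦ.1 X m (fun k => a k.1) ⊆ U := by
  obtain ⟨y, hy⟩ := hX.2 Φ hΦ a
  obtain rfl : x = y := by
    have : x ∈ ({y} : Set (↥ζ → Cantor)) := hy ▸ mem_iInter.2 hx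
    exact this
  have hcl : ∀ m, IsClosed (XPhi hζ Φ hΦ.1 X m (fun k => a k.1)) := fun m =>
    (hX.pe_XPhi hΦ.1 m _).1.1.1
  refine exists_subset_nhds_of_isCompact' (XPhi_antitone hΦ.1 a).directed_ge
    (fun m => (hcl m).isCompact) hcl ?_
  rw [hy]
  rintro _ rfl
  exact hU.mem_nhds hxU

end

theorem stmt17 (I : Type) [PartialOrder I] [Countable I]
    (F : (↥(Set.univ : Set I) → Cantor) → (ℕ → ℕ)) (hF : Continuous F)
    (ξ : Set I) (hξ : IsLowerSet ξ)
    (X₁ X₂ : Set (↥(Set.univ : Set I) → Cantor)) (hX₁ : Perf X₁) (hX₂ : Perf X₂)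
    (hres : resSet (Set.subset_univ ξ) X₁ = resSet (Set.subset_univ ξ) X₂) :
    Reducible F ξ (X₁ ∪ X₂) ∨
      ∃ X₁' X₂' : Set (↥(Set.univ : Set I) → Cantor),
        Perf X₁' ∧ Perf X₂' ∧ X₁' ⊆ X₁ ∧ X₂' ⊆ X₂ ∧
        resSet (Set.subset_univ ξ) X₁' = resSet (Set.subset_univ ξ) X₂' ∧
        F '' X₁' ∩ F '' X₂' = ∅ := by
  by_cases hred : Reducible F ξ (X₁ ∪ X₂)
  · exact Or.inl hred
  refine Or.inr ?_
  obtain ⟨x, hx, y, hy, hxy, hne⟩ := exists_ne_of_not_reducible hres hred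
  have : Nonempty I := by
    by_contra h
    rw [not_nonempty_iff] at h
    exact hne (congrArg F (Subsingleton.elim x y))
  obtain ⟨Φ, hΦ⟩ := exists_admissible_univ (I := I)
  obtain ⟨U, V, hU, hV, hxU, hyV, hUV⟩ := t2_separation hne
  obtain ⟨a, ha⟩ := exists_forall_mem_XPhi (hζ := isLowerSet_univ) hΦ.1 hx
  obtain ⟨b, hb⟩ := exists_forall_mem_XPhi (hζ := isLowerSet_univ) hΦ.1 hy
  obtain ⟨m, hm⟩ := Pe.exists_XPhi_subset hX₁ hΦ ha (hU.preimage hF) hxU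
  obtain ⟨n, hn⟩ := Pe.exists_XPhi_subset hX₂ hΦ hb (hV.preimage hF) hyV
  refine ⟨_, _, Pe.pe_XPhi hX₁ hΦ.1 (max m n) (fun k => a k.1),
    Pe.pe_XPhi hX₂ hΦ.1 (max m n) (fun k => b k.1), XPhi_antitone hΦ.1 a (Nat.zero_le _),
    XPhi_antitone hΦ.1 b (Nat.zero_le _),
    resSet_XPhi_eq hX₁ hX₂ hξ (Set.subset_univ ξ) hres hΦ.1 hxy ha hb _, ?_⟩
  rw [← Set.disjoint_iff_inter_eq_empty]
  exact hUV.mono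
    (Set.image_subset_iff.2 ((XPhi_antitone hΦ.1 a (le_max_left m n)).trans hm))
    (Set.image_subset_iff.2 ((XPhi_antitone hΦ.1 b (le_max_right m n)).trans hn))
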